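/- arXiv:1306.3142 — 2 statements merged into one kernel-verified Lean document; each statement's English description precedes it below -/
import Mathlib

section
/- Let ρ, σ be positive semidefinite complex n×n matrices with ρ ≠ 0 and σ ≫ ρ. Then D̃_α(ρ‖σ) converges, as α → ∞, to the max relative entropy D_max(ρ‖σ) = inf { λ ∈ ℝ : 2^λ · σ − ρ is positive semidefinite }. -/
open Matrix
open scoped Kronecker Classical ComplexOrder

/-- Real power of a matrix via functional calculus on the eigenvalues of a Hermitian
matrix, with the convention that eigenvalue `0` is mapped to `0` (powers are taken on
the support). Non-Hermitian matrices are mapped to `0`. -/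
noncomputable def matPow {n : Type*} [Fintype n] [DecidableEq n]
    (A : Matrix n n ℂ) (t : ℝ) : Matrix n n ℂ :=
  if hA : A.IsHermitian then
    (hA.eigenvectorUnitary : Matrix n n ℂ) *
      Matrix.diagonal (fun i =>
        ((if hA.eigenvalues i = 0 then (0 : ℝ) else hA.eigenvalues i ^ t : ℝ) : ℂ)) *
      (star (hA.eigenvectorUnitary : Matrix n n ℂ))
  else 0

/-- `dominates σ ρ` (written `σ ≫ ρ` in the paper): the kernel of `σ` is contained in
the kernel of `ρ`. -/
def dominates {n : Type*} [Fintype n] (σ ρ : Matrix n n ℂ) : Prop :=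
  ∀ v : n → ℂ, σ.mulVec v = 0 → ρ.mulVec v = 0

/-- The sandwiched Rényi divergence of order `α`, with values in `ℝ ∪ {+∞}` (as a
subset of `EReal`), logarithms base 2. It is `+∞` unless `ρ` is not orthogonal to `σ`
(i.e. `Tr[ρσ] ≠ 0`) and (`σ ≫ ρ` or `α < 1`). -/
noncomputable def Dtilde {n : Type*} [Fintype n] [DecidableEq n]
    (α : ℝ) (ρ σ : Matrix n n ℂ) : EReal :=
  if (ρ * σ).trace ≠ 0 ∧ (dominates σ ρ ∨ α < 1) then
    (((α - 1)⁻¹ * Real.logb 2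
        ((matPow (matPow σ ((1 - α) / (2 * α)) * ρ * matPow σ ((1 - α) / (2 * α))) α).trace.re
          / ρ.trace.re) : ℝ) : EReal)
  else ⊤

open scoped Matrix.Norms.L2Operator MatrixOrder

section MatPow

variable {m : Type*} [Fintype m] [DecidableEq m] {A : Matrix m m ℂ}

lemma matPow_isHermitian (A : Matrix m m ℂ) (t : ℝ) : (matPow A t).IsHermitian := by
  unfold matPow
  split_ifs with hA
  · rw [star_eq_conjTranspose]
    refine isHermitian_mul_mul_conjTranspose _ (isHermitian_diagonal_of_self_adjoint _ ?_)
    ext i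
    simp
  · exact isHermitian_zero

lemma matPow_mul_matPow (hA : A.PosSemidef) (s t : ℝ) :
    matPow A s * matPow A t = matPow A (s + t) := by
  simp only [matPow, dif_pos hA.1]
  set U : Matrix m m ℂ := (hA.1.eigenvectorUnitary : Matrix m m ℂ)
  have hUU : star U * U = 1 := Unitary.coe_star_mul_self _
  have assoc (D E : Matrix m m ℂ) :
      U * D * star U * (U * E * star U) = U * (D * (star U * U) * E) * star U := by
    simp only [Matrix.mul_assoc]
  rw [assoc, hUU, Matrix.mul_one, diagonal_mul_diagonal]
  congr 3
  funext i
  split_ifs with h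
  · simp
  · rw [← Complex.ofReal_mul,
      Real.rpow_add ((hA.eigenvalues_nonneg i).lt_of_ne' h)]

lemma matPow_one (hA : A.IsHermitian) : matPow A 1 = A := by
  conv_rhs => rw [hA.spectral_theorem]
  simp only [matPow, dif_pos hA, Unitary.conjStarAlgAut_apply]
  congr 3
  funext i
  split_ifs with h <;> simp [h]

lemma continuous_matPow (A : Matrix m m ℂ) : Continuous (matPow A) := by
  unfold matPow
  split_ifs with hA
  · refine (continuous_const.matrix_mul (Continuous.matrix_diagonal
      (continuous_pi fun i => ?_))).matrix_mul continuous_const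
    split_ifs with h
    · exact continuous_const
    · exact Complex.continuous_ofReal.comp (Real.continuous_const_rpow h)
  · exact continuous_const

lemma trace_matPow (hA : A.IsHermitian) {t : ℝ} (ht : t ≠ 0) :
    (matPow A t).trace.re = ∑ i, hA.eigenvalues i ^ t := by
  simp only [matPow, dif_pos hA]
  rw [trace_mul_cycle, Unitary.coe_star_mul_self, Matrix.one_mul, trace_diagonal,
    Complex.re_sum]
  refine Finset.sum_congr rfl fun i _ => ?_
  split_ifs with h <;> simp [h, Real.zero_rpow ht]

lemma norm_eq_norm_eigenvalues (hA : A.IsHermitian) : ‖A‖ = ‖hA.eigenvalues‖ := by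
  conv_lhs => rw [hA.spectral_theorem]
  rw [Unitary.conjStarAlgAut_apply, CStarRing.norm_mul_mem_unitary _
    (Unitary.star_mem hA.eigenvectorUnitary.2), CStarRing.norm_coe_unitary_mul,
    l2_opNorm_diagonal]
  simp [Pi.norm_def]

lemma trace_matPow_le (hA : A.PosSemidef) {t : ℝ} (ht : 0 < t) :
    (matPow A t).trace.re ≤ Fintype.card m * ‖A‖ ^ t := by
  rw [trace_matPow hA.1 ht.ne', norm_eq_norm_eigenvalues hA.1, ← nsmul_eq_mul]
  refine Finset.sum_le_card_nsmul _ _ _ fun i _ => ?_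
  exact Real.rpow_le_rpow (hA.eigenvalues_nonneg i)
    ((le_abs_self _).trans (norm_le_pi_norm hA.1.eigenvalues i)) ht.le

lemma rpow_norm_le_trace_matPow (hA : A.PosSemidef) {t : ℝ} (ht : 0 < t) :
    ‖A‖ ^ t ≤ (matPow A t).trace.re := by
  rw [trace_matPow hA.1 ht.ne', norm_eq_norm_eigenvalues hA.1]
  have hterm (i : m) : 0 ≤ hA.1.eigenvalues i ^ t := Real.rpow_nonneg (hA.eigenvalues_nonneg i) t
  have hsum : 0 ≤ ∑ i, hA.1.eigenvalues i ^ t := Finset.sum_nonneg fun i _ => hterm i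
  rw [← Real.le_rpow_inv_iff_of_pos (norm_nonneg _) hsum ht,
    pi_norm_le_iff_of_nonneg (Real.rpow_nonneg hsum _)]
  intro i
  rw [Real.norm_of_nonneg (hA.eigenvalues_nonneg i),
    Real.le_rpow_inv_iff_of_pos (hA.eigenvalues_nonneg i) hsum ht]
  exact Finset.single_le_sum (fun j _ => hterm j) (Finset.mem_univ i)

lemma posSemidef_one_sub_matPow_zero (hA : A.PosSemidef) : (1 - matPow A 0).PosSemidef := by
  have h := posSemidef_conjTranspose_mul_self (1 - matPow A 0)
  rwa [conjTranspose_sub, conjTranspose_one, (matPow_isHermitian A 0).eq, Matrix.mul_sub,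
    Matrix.sub_mul, Matrix.sub_mul, matPow_mul_matPow hA, Matrix.mul_one, Matrix.one_mul,
    Matrix.mul_one, add_zero, sub_self, sub_zero] at h

lemma mul_matPow_zero {B : Matrix m m ℂ} (hA : A.PosSemidef) (hdom : dominates A B) :
    B * matPow A 0 = B := by
  have hker : A * (1 - matPow A 0) = 0 := by
    nth_rw 1 [← matPow_one hA.1]
    rw [Matrix.mul_sub, matPow_mul_matPow hA, add_zero, Matrix.mul_one, sub_self]
  have h : B * (1 - matPow A 0) = 0 := by
    refine ext_of_mulVec_single fun i => ?_
    rw [← mulVec_mulVec, zero_mulVec]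
    apply hdom
    rw [mulVec_mulVec, hker, zero_mulVec]
  rw [Matrix.mul_sub, Matrix.mul_one, sub_eq_zero] at h
  exact h.symm

lemma matPow_zero_mul {B : Matrix m m ℂ} (hA : A.PosSemidef) (hB : B.IsHermitian)
    (hdom : dominates A B) : matPow A 0 * B = B := by
  have h := congrArg conjTranspose (mul_matPow_zero hA hdom)
  rwa [conjTranspose_mul, hB.eq, (matPow_isHermitian A 0).eq] at h

lemma posSemidef_matPow_mul_mul_matPow {B : Matrix m m ℂ} (A : Matrix m m ℂ)
    (hB : B.PosSemidef) (t : ℝ) : (matPow A t * B * matPow A t).PosSemidef := by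
  have h := hB.mul_mul_conjTranspose_same (matPow A t)
  rwa [(matPow_isHermitian A t).eq] at h

lemma matPow_conj_matPow_conj {B : Matrix m m ℂ} (hA : A.PosSemidef) (hB : B.IsHermitian)
    (hdom : dominates A B) (t : ℝ) :
    matPow A t * (matPow A (-t) * B * matPow A (-t)) * matPow A t = B := by
  calc _ = matPow A t * matPow A (-t) * B * (matPow A (-t) * matPow A t) := by
        simp only [Matrix.mul_assoc]
    _ = B := by
        rw [matPow_mul_matPow hA, matPow_mul_matPow hA, add_neg_cancel, neg_add_cancel,
          matPow_zero_mul hA hB hdom, mul_matPow_zero hA hdom]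

lemma norm_le_iff_posSemidef (hA : A.PosSemidef) {c : ℝ} (hc : 0 ≤ c) :
    ‖A‖ ≤ c ↔ ((c : ℂ) • (1 : Matrix m m ℂ) - A).PosSemidef := by
  rw [CStarAlgebra.norm_le_iff_le_algebraMap A hc hA.nonneg, Matrix.le_iff,
    Algebra.algebraMap_eq_smul_one, Complex.coe_smul]

lemma posSemidef_smul_sub_iff {B : Matrix m m ℂ} (hA : A.PosSemidef) (hB : B.PosSemidef)
    (hdom : dominates A B) {c : ℝ} (hc : 0 ≤ c) :
    ((c : ℂ) • A - B).PosSemidef ↔ ‖matPow A (-(1 / 2)) * B * matPow A (-(1 / 2))‖ ≤ c := by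
  have hc' : (0 : ℂ) ≤ c := by exact_mod_cast hc
  rw [norm_le_iff_posSemidef (posSemidef_matPow_mul_mul_matPow A hB _) hc]
  have hpow (s t u : ℝ) (h : s + 1 + t = u) : matPow A s * A * matPow A t = matPow A u := by
    nth_rw 2 [← matPow_one hA.1]
    rw [matPow_mul_matPow hA, matPow_mul_matPow hA, h]
  constructor <;> intro h
  · have h1 := posSemidef_matPow_mul_mul_matPow A h (-(1 / 2))
    rw [Matrix.mul_sub, Matrix.sub_mul, Matrix.mul_smul, Matrix.smul_mul,
      hpow _ _ 0 (by norm_num)] at h1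
    have h2 := h1.add ((posSemidef_one_sub_matPow_zero hA).smul hc')
    convert h2 using 1
    rw [smul_sub]
    abel
  · have h1 := posSemidef_matPow_mul_mul_matPow A h (1 / 2)
    rw [Matrix.mul_sub, Matrix.sub_mul, Matrix.mul_smul, Matrix.smul_mul, Matrix.mul_one,
      matPow_mul_matPow hA, add_halves, matPow_one hA.1,
      matPow_conj_matPow_conj hA hB.1 hdom] at h1
    exact h1

lemma setOf_posSemidef_eq_Ici {B : Matrix m m ℂ} (hA : A.PosSemidef) (hB : B.PosSemidef)
    (hdom : dominates A B) (hB0 : 0 < ‖matPow A (-(1 / 2)) * B * matPow A (-(1 / 2))‖) :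
    {l : ℝ | ((((2 : ℝ) ^ l : ℝ) : ℂ) • A - B).PosSemidef} =
      Set.Ici (Real.logb 2 ‖matPow A (-(1 / 2)) * B * matPow A (-(1 / 2))‖) := by
  ext l
  rw [Set.mem_ofPred_eq, Set.mem_Ici, posSemidef_smul_sub_iff hA hB hdom (by positivity),
    Real.logb_le_iff_le_rpow one_lt_two hB0]

lemma trace_mul_ne_zero_of_dominates {B : Matrix m m ℂ} (hA : A.PosSemidef) (hB : B.PosSemidef)
    (hB0 : B ≠ 0) (hdom : dominates A B) : (B * A).trace ≠ 0 := by
  intro h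
  have hconj : matPow A (1 / 2) * B * matPow A (1 / 2) = 0 := by
    rw [← (posSemidef_matPow_mul_mul_matPow A hB _).trace_eq_zero_iff, trace_mul_cycle,
      matPow_mul_matPow hA, add_halves, matPow_one hA.1, trace_mul_comm, h]
  apply hB0
  rw [← matPow_conj_matPow_conj hA hB.1 hdom (-(1 / 2)), neg_neg, hconj, Matrix.mul_zero,
    Matrix.zero_mul]

end MatPow

/-- If `t α` lies between `N α ^ α` and `C * N α ^ α` and `N α → L > 0`, then
`(α - 1)⁻¹ * log (t α / r) → log L`. -/
lemma tendsto_inv_mul_logb_div {N t : ℝ → ℝ} {C L r : ℝ} (hC : 0 < C) (hL : 0 < L) (hr : 0 < r)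
    (hN : Filter.Tendsto N Filter.atTop (nhds L))
    (hlower : ∀ᶠ α in Filter.atTop, N α ^ α ≤ t α)
    (hupper : ∀ᶠ α in Filter.atTop, t α ≤ C * N α ^ α) :
    Filter.Tendsto (fun α : ℝ => (α - 1)⁻¹ * Real.logb 2 (t α / r)) Filter.atTop
      (nhds (Real.logb 2 L)) := by
  have hinv : Filter.Tendsto (fun α : ℝ => (α - 1)⁻¹) Filter.atTop (nhds 0) :=
    tendsto_inv_atTop_zero.comp (Filter.tendsto_atTop_add_const_right _ (-1) Filter.tendsto_id)
  have hratio : Filter.Tendsto (fun α : ℝ => 1 + (α - 1)⁻¹) Filter.atTop (nhds 1) := by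
    simpa using hinv.const_add 1
  have hlog : Filter.Tendsto (fun α => Real.logb 2 (N α)) Filter.atTop (nhds (Real.logb 2 L)) :=
    hN.logb hL.ne'
  have hmain (c : ℝ) : Filter.Tendsto
      (fun α : ℝ => (1 + (α - 1)⁻¹) * Real.logb 2 (N α) + (α - 1)⁻¹ * c) Filter.atTop
      (nhds (Real.logb 2 L)) := by
    simpa using (hratio.mul hlog).add (hinv.mul_const c)
  have hNpos : ∀ᶠ α in Filter.atTop, 0 < N α := hN.eventually_const_lt hL
  refine tendsto_of_tendsto_of_tendsto_of_le_of_le' (hmain (-Real.logb 2 r))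
    (hmain (Real.logb 2 C - Real.logb 2 r)) ?_ ?_
  · filter_upwards [hlower, hNpos, Filter.eventually_gt_atTop 1] with α h1 h2 h3
    have hα : 0 < α - 1 := sub_pos.2 h3
    have hp : 0 < N α ^ α := Real.rpow_pos_of_pos h2 α
    have hl := Real.logb_le_logb_of_le one_lt_two hp h1
    rw [Real.logb_rpow_eq_mul_logb_of_pos h2] at hl
    rw [Real.logb_div (hp.trans_le h1).ne' hr.ne']
    calc _ = (α - 1)⁻¹ * (α * Real.logb 2 (N α) - Real.logb 2 r) := by
          field_simp
          ring
      _ ≤ _ := by gcongr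
  · filter_upwards [hlower, hupper, hNpos, Filter.eventually_gt_atTop 1] with α h0 h1 h2 h3
    have hα : 0 < α - 1 := sub_pos.2 h3
    have hp : 0 < N α ^ α := Real.rpow_pos_of_pos h2 α
    have hl := Real.logb_le_logb_of_le one_lt_two (hp.trans_le h0) h1
    rw [Real.logb_mul hC.ne' hp.ne', Real.logb_rpow_eq_mul_logb_of_pos h2] at hl
    rw [Real.logb_div (hp.trans_le h0).ne' hr.ne']
    calc _ ≤ (α - 1)⁻¹ * (Real.logb 2 C + α * Real.logb 2 (N α) - Real.logb 2 r) := by gcongr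
      _ = _ := by
          field_simp
          ring

/-- the sandwiched Rényi divergence converges, as `α → ∞`, to the max
relative entropy `D_max(ρ‖σ) = inf {l : 2^l • σ - ρ is PSD}`. -/
theorem stmt5 {n : ℕ} {ρ σ : Matrix (Fin n) (Fin n) ℂ}
    (hρ : ρ.PosSemidef) (hσ : σ.PosSemidef) (hρ0 : ρ ≠ 0) (hdom : dominates σ ρ) :
    Filter.Tendsto (fun α : ℝ => Dtilde α ρ σ) Filter.atTop
      (nhds ((sInf {l : ℝ | ((((2 : ℝ) ^ l : ℝ) : ℂ) • σ - ρ).PosSemidef} : ℝ) : EReal)) := by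
  set Y := matPow σ (-(1 / 2)) * ρ * matPow σ (-(1 / 2)) with hY
  have hYpos : 0 < ‖Y‖ := by
    refine norm_pos_iff.2 fun h => hρ0 ?_
    rw [← matPow_conj_matPow_conj hσ hρ.1 hdom (1 / 2), ← hY, h, Matrix.mul_zero, Matrix.zero_mul]
  have hn : 0 < n := by
    rcases Nat.eq_zero_or_pos n with rfl | h
    · exact absurd (Subsingleton.elim ρ 0) hρ0
    · exact h
  have htr : 0 < ρ.trace.re := by
    have h : 0 < ρ.trace :=
      hρ.trace_nonneg.lt_of_ne' fun h => hρ0 (hρ.trace_eq_zero_iff.1 h)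
    exact (Complex.lt_def.1 h).1
  have hexp : Filter.Tendsto (fun α : ℝ => (1 - α) / (2 * α)) Filter.atTop
      (nhds (-(1 / 2))) := by
    have h : Filter.Tendsto (fun α : ℝ => 2⁻¹ * α⁻¹ - 1 / 2) Filter.atTop (nhds (-(1 / 2))) := by
      simpa using (tendsto_inv_atTop_zero.const_mul (2⁻¹ : ℝ)).sub_const (1 / 2 : ℝ)
    refine h.congr' ?_
    filter_upwards [Filter.eventually_gt_atTop 0] with α hα
    field_simp
  have hcont : Continuous fun t : ℝ => ‖matPow σ t * ρ * matPow σ t‖ :=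
    (((continuous_matPow σ).matrix_mul continuous_const).matrix_mul (continuous_matPow σ)).norm
  rw [setOf_posSemidef_eq_Ici hσ hρ hdom hYpos, csInf_Ici]
  simp only [Dtilde, if_pos (And.intro (trace_mul_ne_zero_of_dominates hσ hρ hρ0 hdom)
    (Or.inl hdom))]
  refine (continuous_coe_real_ereal.tendsto _).comp
    (tendsto_inv_mul_logb_div (Nat.cast_pos.2 hn) hYpos htr ((hcont.tendsto _).comp hexp) ?_ ?_)
  · filter_upwards [Filter.eventually_gt_atTop 0] with α hα
    exact rpow_norm_le_trace_matPow (posSemidef_matPow_mul_mul_matPow σ hρ _) hα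
  · filter_upwards [Filter.eventually_gt_atTop 0] with α hα
    simpa using trace_matPow_le (posSemidef_matPow_mul_mul_matPow σ hρ ((1 - α) / (2 * α))) hα
end

section
/- Let α ∈ [1, 2] and define Q_α(ρ, σ) = Tr[(σ^((1−α)/(2α)) ρ σ^((1−α)/(2α)))^α] for ρ positive semidefinite and σ positive definite complex n×n matrices. Then Q_α is jointly convex: for all λ ∈ [0,1], ρ₁, ρ₂ positive semidefinite, and σ₁, σ₂ positive definite, Q_α(λρ₁ + (1−λ)ρ₂, λσ₁ + (1−λ)σ₂) ≤ λ·Q_α(ρ₁, σ₁) + (1−λ)·Q_α(ρ₂, σ₂). -/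
open Matrix
open scoped Kronecker Classical ComplexOrder

/-- `Q_α(ρ, σ) = Tr[(σ^((1-α)/(2α)) ρ σ^((1-α)/(2α)))^α]`. -/
noncomputable def Qalpha {n : Type*} [Fintype n] [DecidableEq n]
    (α : ℝ) (ρ σ : Matrix n n ℂ) : ℝ :=
  (matPow (matPow σ ((1 - α) / (2 * α)) * ρ * matPow σ ((1 - α) / (2 * α))) α).trace.re

section SupportPowers

variable {n : Type*} [Fintype n] [DecidableEq n]

/-- The real power with the convention `0 ^ t = 0`, also for `t = 0`. -/
noncomputable def suppRpow (t x : ℝ) : ℝ := if x = 0 then 0 else x ^ t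

lemma suppRpow_of_ne {t : ℝ} (ht : t ≠ 0) (x : ℝ) : suppRpow t x = x ^ t := by
  unfold suppRpow
  split_ifs with h
  · rw [h, Real.zero_rpow ht]
  · rfl

lemma suppRpow_nonneg (t : ℝ) {x : ℝ} (hx : 0 ≤ x) : 0 ≤ suppRpow t x := by
  unfold suppRpow
  split_ifs
  · rfl
  · positivity

lemma suppRpow_mul_suppRpow (s t : ℝ) {x : ℝ} (hx : 0 ≤ x) :
    suppRpow s x * suppRpow t x = suppRpow (s + t) x := by
  unfold suppRpow
  split_ifs with h
  · simp
  · rw [Real.rpow_add (lt_of_le_of_ne hx (Ne.symm h))]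

lemma suppRpow_suppRpow (s t : ℝ) {x : ℝ} (hx : 0 ≤ x) :
    suppRpow t (suppRpow s x) = suppRpow (s * t) x := by
  by_cases h : x = 0
  · simp [suppRpow, h]
  · have hx' : 0 < x := lt_of_le_of_ne hx (Ne.symm h)
    simp [suppRpow, h, (Real.rpow_pos_of_pos hx' s).ne', Real.rpow_mul hx]

lemma Matrix.IsHermitian.cfc_eq_mul {A : Matrix n n ℂ} (hA : A.IsHermitian) (f : ℝ → ℝ) :
    cfc f A = (hA.eigenvectorUnitary : Matrix n n ℂ) *
      diagonal (fun i => ((f (hA.eigenvalues i) : ℝ) : ℂ)) *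
      (hA.eigenvectorUnitary : Matrix n n ℂ)ᴴ := by
  rw [hA.cfc_eq, Matrix.IsHermitian.cfc, Unitary.conjStarAlgAut_apply]
  rfl

lemma matPow_eq_cfc {A : Matrix n n ℂ} (hA : A.IsHermitian) (t : ℝ) :
    matPow A t = cfc (suppRpow t) A := by
  rw [hA.cfc_eq_mul, matPow, dif_pos hA]
  rfl

lemma trace_mul_diagonal_mul_conjTranspose_mul_diagonal (N : Matrix n n ℂ) (d e : n → ℝ) :
    (N * diagonal (fun i => (d i : ℂ)) * Nᴴ * diagonal (fun j => (e j : ℂ))).trace.re =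
      ∑ i, ∑ j, d i * e j * Complex.normSq (N j i) := by
  rw [Finset.sum_comm]
  simp only [Matrix.trace, Matrix.diag_apply, Matrix.mul_diagonal, Complex.re_sum]
  refine Finset.sum_congr rfl fun j _ => ?_
  rw [Matrix.mul_apply, Finset.sum_mul, Complex.re_sum]
  refine Finset.sum_congr rfl fun i _ => ?_
  have h : N j i * (d i : ℂ) * star (N j i) * (e j : ℂ) =
      ((d i * e j * Complex.normSq (N j i) : ℝ) : ℂ) := by
    push_cast
    rw [← Complex.mul_conj]
    simp only [Complex.star_def]
    ring
  rw [Matrix.mul_diagonal, Matrix.conjTranspose_apply, h, Complex.ofReal_re]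

lemma Matrix.IsHermitian.conjTranspose_mul_eigenvectorUnitary {A : Matrix n n ℂ}
    (hA : A.IsHermitian) :
    (hA.eigenvectorUnitary : Matrix n n ℂ)ᴴ * (hA.eigenvectorUnitary : Matrix n n ℂ) = 1 :=
  Unitary.coe_star_mul_self _

/-- The matrix of `K` with respect to eigenbases of `A` (source) and `B` (target). -/
noncomputable def eigenCoord {A B : Matrix n n ℂ} (hA : A.IsHermitian) (hB : B.IsHermitian)
    (K : Matrix n n ℂ) : Matrix n n ℂ :=
  (hB.eigenvectorUnitary : Matrix n n ℂ)ᴴ * K * (hA.eigenvectorUnitary : Matrix n n ℂ)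

lemma eigenCoord_surjective {A B : Matrix n n ℂ} (hA : A.IsHermitian) (hB : B.IsHermitian) :
    Function.Surjective (eigenCoord hA hB) := by
  intro N
  refine ⟨(hB.eigenvectorUnitary : Matrix n n ℂ) * N *
    (hA.eigenvectorUnitary : Matrix n n ℂ)ᴴ, ?_⟩
  simp only [eigenCoord, Matrix.mul_assoc, hA.conjTranspose_mul_eigenvectorUnitary]
  simp only [← Matrix.mul_assoc, hB.conjTranspose_mul_eigenvectorUnitary]
  simp

lemma eigenCoord_add {A B : Matrix n n ℂ} (hA : A.IsHermitian) (hB : B.IsHermitian)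
    (X Z : Matrix n n ℂ) : eigenCoord hA hB (X + Z) = eigenCoord hA hB X + eigenCoord hA hB Z := by
  simp [eigenCoord, Matrix.mul_add, Matrix.add_mul]

lemma eigenCoord_sub {A B : Matrix n n ℂ} (hA : A.IsHermitian) (hB : B.IsHermitian)
    (X Z : Matrix n n ℂ) : eigenCoord hA hB (X - Z) = eigenCoord hA hB X - eigenCoord hA hB Z := by
  simp [eigenCoord, Matrix.mul_sub, Matrix.sub_mul]

lemma trace_cfc_mul_cfc {A B : Matrix n n ℂ} (hA : A.IsHermitian) (hB : B.IsHermitian)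
    (K : Matrix n n ℂ) (f g : ℝ → ℝ) :
    (K * cfc f A * Kᴴ * cfc g B).trace.re =
      ∑ i, ∑ j, f (hA.eigenvalues i) * g (hB.eigenvalues j) *
        Complex.normSq (eigenCoord hA hB K j i) := by
  rw [← trace_mul_diagonal_mul_conjTranspose_mul_diagonal, hA.cfc_eq_mul, hB.cfc_eq_mul]
  simp only [eigenCoord, Matrix.conjTranspose_mul, Matrix.conjTranspose_conjTranspose,
    Matrix.mul_assoc]
  rw [Matrix.trace_mul_comm (hB.eigenvectorUnitary : Matrix n n ℂ)ᴴ]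
  simp only [Matrix.mul_assoc]

lemma trace_mul_mul_conjTranspose {A B : Matrix n n ℂ} (hA : A.IsHermitian) (hB : B.IsHermitian)
    (K : Matrix n n ℂ) :
    (K * A * Kᴴ).trace.re = ∑ i, ∑ j, hA.eigenvalues i *
        Complex.normSq (eigenCoord hA hB K j i) := by
  have h := trace_cfc_mul_cfc hA hB K (fun x => x) (fun _ => 1)
  rw [cfc_id' ℝ A hA.isSelfAdjoint, cfc_const_one ℝ B hB.isSelfAdjoint] at h
  simpa using h

lemma trace_mul_conjTranspose_mul {A B : Matrix n n ℂ} (hA : A.IsHermitian) (hB : B.IsHermitian)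
    (K : Matrix n n ℂ) :
    (K * Kᴴ * B).trace.re = ∑ i, ∑ j, hB.eigenvalues j *
        Complex.normSq (eigenCoord hA hB K j i) := by
  have h := trace_cfc_mul_cfc hA hB K (fun _ => 1) (fun x => x)
  rw [cfc_id' ℝ B hB.isSelfAdjoint, cfc_const_one ℝ A hA.isSelfAdjoint] at h
  simpa using h

lemma trace_cfc {A : Matrix n n ℂ} (hA : A.IsHermitian) (f : ℝ → ℝ) :
    (cfc f A).trace.re = ∑ i, f (hA.eigenvalues i) := by
  rw [hA.cfc_eq_mul, Matrix.trace_mul_comm, ← Matrix.mul_assoc,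
    hA.conjTranspose_mul_eigenvectorUnitary, Matrix.one_mul, Matrix.trace_diagonal,
    Complex.re_sum]
  simp

lemma continuousOn_spectrum (A : Matrix n n ℂ) (f : ℝ → ℝ) : ContinuousOn f (spectrum ℝ A) :=
  (Matrix.finite_real_spectrum (A := A)).continuousOn f

lemma continuousOn_image_spectrum (A : Matrix n n ℂ) (f g : ℝ → ℝ) :
    ContinuousOn f (g '' spectrum ℝ A) :=
  ((Matrix.finite_real_spectrum (A := A)).image g).continuousOn f

lemma Matrix.PosSemidef.nonneg_of_mem_spectrum {A : Matrix n n ℂ} (hA : A.PosSemidef) {x : ℝ}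
    (hx : x ∈ spectrum ℝ A) : 0 ≤ x := by
  rw [hA.1.spectrum_real_eq_range_eigenvalues] at hx
  obtain ⟨i, rfl⟩ := hx
  exact hA.eigenvalues_nonneg i

lemma Matrix.PosSemidef.cfc_suppRpow {A : Matrix n n ℂ} (hA : A.PosSemidef) (t : ℝ) :
    (cfc (suppRpow t) A).PosSemidef := by
  rw [hA.1.cfc_eq_mul]
  refine Matrix.PosSemidef.mul_mul_conjTranspose_same (Matrix.PosSemidef.diagonal ?_) _
  intro i
  have := suppRpow_nonneg t (hA.eigenvalues_nonneg i)
  simpa using this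

lemma cfc_suppRpow_mul {A : Matrix n n ℂ} (hA : A.PosSemidef) (s t : ℝ) :
    cfc (suppRpow s) A * cfc (suppRpow t) A = cfc (suppRpow (s + t)) A := by
  rw [← cfc_mul _ _ A (continuousOn_spectrum A _) (continuousOn_spectrum A _)]
  exact cfc_congr fun x hx => suppRpow_mul_suppRpow s t (hA.nonneg_of_mem_spectrum hx)

lemma cfc_suppRpow_cfc_suppRpow {A : Matrix n n ℂ} (hA : A.PosSemidef) (s t : ℝ) :
    cfc (suppRpow t) (cfc (suppRpow s) A) = cfc (suppRpow (s * t)) A := by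
  rw [← cfc_comp' _ _ A (continuousOn_image_spectrum A _ _) (continuousOn_spectrum A _) hA.1.isSelfAdjoint]
  exact cfc_congr fun x hx => suppRpow_suppRpow s t (hA.nonneg_of_mem_spectrum hx)

lemma cfc_suppRpow_one {A : Matrix n n ℂ} (hA : A.IsHermitian) : cfc (suppRpow 1) A = A := by
  conv_rhs => rw [← cfc_id' ℝ A hA.isSelfAdjoint]
  exact cfc_congr fun x _ => by simp [suppRpow_of_ne one_ne_zero]

lemma cfc_suppRpow_zero {A : Matrix n n ℂ} (hA : A.PosDef) : cfc (suppRpow 0) A = 1 := by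
  rw [← cfc_const_one ℝ A hA.1.isSelfAdjoint]
  refine cfc_congr fun x hx => ?_
  rw [hA.1.spectrum_real_eq_range_eigenvalues] at hx
  obtain ⟨i, rfl⟩ := hx
  simp [suppRpow, (hA.eigenvalues_pos i).ne']

/-- `Tr f(M* M) = Tr f(M M*)`. -/
lemma trace_cfc_conjTranspose_mul_self (M : Matrix n n ℂ) (f : ℝ → ℝ) :
    (cfc f (Mᴴ * M)).trace.re = (cfc f (M * Mᴴ)).trace.re := by
  rw [trace_cfc (isHermitian_conjTranspose_mul_self M),
    trace_cfc (isHermitian_mul_conjTranspose_self M),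
    (IsHermitian.eigenvalues_eq_eigenvalues_iff _ _).2 (charpoly_mul_comm Mᴴ M)]

end SupportPowers

section LiebConcavity

lemma posSemidef_convexCombination {n : Type*} {l : ℝ} (hl : l ∈ Set.Icc (0 : ℝ) 1)
    {A₁ A₂ : Matrix n n ℂ}
    (hA₁ : A₁.PosSemidef) (hA₂ : A₂.PosSemidef) :
    ((l : ℂ) • A₁ + ((1 - l : ℝ) : ℂ) • A₂).PosSemidef :=
  (hA₁.smul (by exact_mod_cast hl.1)).add
    (hA₂.smul (by exact_mod_cast (sub_nonneg.2 hl.2)))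
variable {n : Type*} [Fintype n] [DecidableEq n]

/-- The parallel sum of two nonnegative numbers. -/
noncomputable def parallelSum (a b : ℝ) : ℝ := a * b / (a + b)

lemma parallelSum_mul_normSq_add_le {a b : ℝ} (ha : 0 ≤ a) (hb : 0 ≤ b) (x z : ℂ) :
    parallelSum a b * Complex.normSq (x + z) ≤ a * Complex.normSq x + b * Complex.normSq z := by
  unfold parallelSum
  rcases (add_nonneg ha hb).eq_or_lt with h | h
  · rw [← h]
    have h1 := Complex.normSq_nonneg x
    have h2 := Complex.normSq_nonneg z
    simp only [div_zero, zero_mul]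
    positivity
  · rw [div_mul_eq_mul_div, div_le_iff₀ h]
    simp only [Complex.normSq_apply, Complex.add_re, Complex.add_im]
    nlinarith [sq_nonneg (a * x.re - b * z.re), sq_nonneg (a * x.im - b * z.im)]

lemma exists_parallelSum_mul_normSq_eq {a b : ℝ} (ha : 0 ≤ a) (hb : 0 ≤ b) (k : ℂ) :
    ∃ x : ℂ, a * Complex.normSq x + b * Complex.normSq (k - x) =
      parallelSum a b * Complex.normSq k := by
  rcases (add_nonneg ha hb).eq_or_lt with h | h
  · refine ⟨k, ?_⟩
    have : a = 0 := by linarith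
    simp [parallelSum, this]
  · refine ⟨((b / (a + b) : ℝ) : ℂ) * k, ?_⟩
    have h1 : k - ((b / (a + b) : ℝ) : ℂ) * k = ((a / (a + b) : ℝ) : ℂ) * k := by
      have : (a / (a + b) : ℝ) = 1 - b / (a + b) := by field_simp; ring
      rw [this]
      push_cast
      ring
    rw [h1, Complex.normSq_mul, Complex.normSq_mul, Complex.normSq_ofReal, Complex.normSq_ofReal,
      parallelSum]
    field_simp
    ring

/-- The parallel sum of right multiplication by `B` and left multiplication by `t⁻¹ A`,
as a quadratic form in `K`. -/
noncomputable def parallelForm (t : ℝ) {A B : Matrix n n ℂ} (hA : A.IsHermitian)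
    (hB : B.IsHermitian) (K : Matrix n n ℂ) : ℝ :=
  ∑ i, ∑ j, parallelSum (hB.eigenvalues j) (hA.eigenvalues i / t) *
    Complex.normSq (eigenCoord hA hB K j i)

lemma parallelForm_add_le {t : ℝ} (ht : 0 < t) {A B : Matrix n n ℂ} (hA : A.PosSemidef)
    (hB : B.PosSemidef) (X Z : Matrix n n ℂ) :
    parallelForm t hA.1 hB.1 (X + Z) ≤
      (X * Xᴴ * B).trace.re + t⁻¹ * (Z * A * Zᴴ).trace.re := by
  rw [trace_mul_mul_conjTranspose hA.1 hB.1, trace_mul_conjTranspose_mul hA.1 hB.1,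
    Finset.mul_sum, ← Finset.sum_add_distrib, parallelForm]
  refine Finset.sum_le_sum fun i _ => ?_
  rw [Finset.mul_sum, ← Finset.sum_add_distrib]
  refine Finset.sum_le_sum fun j _ => ?_
  have h := parallelSum_mul_normSq_add_le (hB.eigenvalues_nonneg j)
    (div_nonneg (hA.eigenvalues_nonneg i) ht.le) (eigenCoord hA.1 hB.1 X j i)
    (eigenCoord hA.1 hB.1 Z j i)
  rw [eigenCoord_add, Matrix.add_apply]
  refine h.trans (le_of_eq ?_)
  ring

lemma exists_parallelForm_eq {t : ℝ} (ht : 0 < t) {A B : Matrix n n ℂ} (hA : A.PosSemidef)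
    (hB : B.PosSemidef) (K : Matrix n n ℂ) :
    ∃ X : Matrix n n ℂ, (X * Xᴴ * B).trace.re + t⁻¹ * ((K - X) * A * (K - X)ᴴ).trace.re =
      parallelForm t hA.1 hB.1 K := by
  choose x hx using fun j i => exists_parallelSum_mul_normSq_eq (hB.eigenvalues_nonneg j)
    (div_nonneg (hA.eigenvalues_nonneg i) ht.le) (eigenCoord hA.1 hB.1 K j i)
  obtain ⟨X, hX⟩ := eigenCoord_surjective hA.1 hB.1 (Matrix.of x)
  refine ⟨X, ?_⟩
  rw [trace_mul_mul_conjTranspose hA.1 hB.1, trace_mul_conjTranspose_mul hA.1 hB.1,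
    Finset.mul_sum, ← Finset.sum_add_distrib, parallelForm]
  refine Finset.sum_congr rfl fun i _ => ?_
  rw [Finset.mul_sum, ← Finset.sum_add_distrib]
  refine Finset.sum_congr rfl fun j _ => ?_
  rw [← hx j i, eigenCoord_sub, hX, Matrix.sub_apply, Matrix.of_apply]
  ring

lemma parallelForm_concave {t : ℝ} (ht : 0 < t) {l : ℝ} (hl : l ∈ Set.Icc (0 : ℝ) 1)
    {A₁ A₂ B₁ B₂ : Matrix n n ℂ} (hA₁ : A₁.PosSemidef) (hA₂ : A₂.PosSemidef)
    (hB₁ : B₁.PosSemidef) (hB₂ : B₂.PosSemidef) (K : Matrix n n ℂ) :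
    l * parallelForm t hA₁.1 hB₁.1 K + (1 - l) * parallelForm t hA₂.1 hB₂.1 K ≤
      parallelForm t (posSemidef_convexCombination hl hA₁ hA₂).1
        (posSemidef_convexCombination hl hB₁ hB₂).1 K := by
  obtain ⟨X, hX⟩ := exists_parallelForm_eq ht (posSemidef_convexCombination hl hA₁ hA₂)
    (posSemidef_convexCombination hl hB₁ hB₂) K
  have h₁ := parallelForm_add_le ht hA₁ hB₁ X (K - X)
  have h₂ := parallelForm_add_le ht hA₂ hB₂ X (K - X)
  rw [add_sub_cancel] at h₁ h₂
  rw [← hX]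
  have h := add_le_add (mul_le_mul_of_nonneg_left h₁ hl.1)
    (mul_le_mul_of_nonneg_left h₂ (sub_nonneg.2 hl.2))
  refine h.trans (le_of_eq ?_)
  simp only [Matrix.mul_add, Matrix.add_mul, Matrix.mul_smul, Matrix.smul_mul, Matrix.trace_add,
    Matrix.trace_smul, smul_eq_mul, Complex.add_re, Complex.re_ofReal_mul]
  ring

open MeasureTheory Set in
lemma exists_measure_trace_eq_integral_parallelForm {p : ℝ} (hp : p ∈ Set.Ioo (0 : ℝ) 1) :
    ∃ μ : Measure ℝ, ∀ {A B : Matrix n n ℂ} (hA : A.PosSemidef) (hB : B.PosSemidef)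
      (K : Matrix n n ℂ),
      IntegrableOn (fun t => t ^ (p - 1) * parallelForm t hA.1 hB.1 K) (Ioi 0) μ ∧
      (K * cfc (suppRpow p) A * Kᴴ * cfc (suppRpow (1 - p)) B).trace.re =
        ∫ t in Ioi 0, t ^ (p - 1) * parallelForm t hA.1 hB.1 K ∂μ := by
  obtain ⟨μ, hμ⟩ := Real.exists_measure_rpow_eq_integral_rpowIntegrand₀₁ hp
  refine ⟨μ, fun {A B} hA hB K => ?_⟩
  have key : ∀ {a b : ℝ}, 0 ≤ a → 0 ≤ b →
      IntegrableOn (fun t => t ^ (p - 1) * parallelSum b (a / t)) (Ioi 0) μ ∧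
      a ^ p * b ^ (1 - p) = ∫ t in Ioi 0, t ^ (p - 1) * parallelSum b (a / t) ∂μ := by
    intro a b ha hb
    have hab := hμ (a / b) (div_nonneg ha hb)
    have heq : Set.EqOn (fun t => b * Real.rpowIntegrand₀₁ p t (a / b))
        (fun t => t ^ (p - 1) * parallelSum b (a / t)) (Ioi 0) := by
      intro t ht
      have ht : 0 < t := ht
      rcases hb.eq_or_lt with rfl | hb
      · simp [parallelSum]
      · have h1 : t + a / b ≠ 0 := by positivity
        have h2 : b + a / t ≠ 0 := by positivity
        have h3 : t * b + a ≠ 0 := by positivity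
        simp only [Real.rpowIntegrand₀₁_eq_pow_div hp ht.le (div_nonneg ha hb.le), parallelSum]
        field_simp
    refine ⟨IntegrableOn.congr_fun (hab.1.const_mul b) heq measurableSet_Ioi, ?_⟩
    rw [← setIntegral_congr_fun measurableSet_Ioi heq, integral_const_mul, ← hab.2]
    rcases hb.eq_or_lt with rfl | hb
    · simp [Real.zero_rpow (sub_pos.2 hp.2).ne']
    · rw [Real.div_rpow ha hb.le, Real.rpow_sub hb, Real.rpow_one]
      ring
  have hsum : (fun t => t ^ (p - 1) * parallelForm t hA.1 hB.1 K) = fun t =>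
      ∑ i, ∑ j, t ^ (p - 1) * parallelSum (hB.1.eigenvalues j) (hA.1.eigenvalues i / t) *
        Complex.normSq (eigenCoord hA.1 hB.1 K j i) := by
    funext t
    simp only [parallelForm, Finset.mul_sum, mul_assoc]
  have hint : ∀ i j, Integrable (fun t => t ^ (p - 1) *
      parallelSum (hB.1.eigenvalues j) (hA.1.eigenvalues i / t) *
        Complex.normSq (eigenCoord hA.1 hB.1 K j i)) (μ.restrict (Ioi 0)) := fun i j =>
    (key (hA.eigenvalues_nonneg i) (hB.eigenvalues_nonneg j)).1.mul_const _
  rw [hsum]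
  refine ⟨integrable_finsetSum _ fun i _ => integrable_finsetSum _ fun j _ => hint i j, ?_⟩
  rw [integral_finsetSum _ fun i _ => integrable_finsetSum _ fun j _ => hint i j,
    trace_cfc_mul_cfc hA.1 hB.1]
  refine Finset.sum_congr rfl fun i _ => ?_
  rw [integral_finsetSum _ fun j _ => hint i j]
  refine Finset.sum_congr rfl fun j _ => ?_
  rw [integral_mul_const, ← (key (hA.eigenvalues_nonneg i) (hB.eigenvalues_nonneg j)).2,
    suppRpow_of_ne hp.1.ne', suppRpow_of_ne (sub_pos.2 hp.2).ne']

/-- **Lieb's concavity theorem**. -/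
lemma lieb_concavity {p : ℝ} (hp : p ∈ Set.Ioo (0 : ℝ) 1) {l : ℝ} (hl : l ∈ Set.Icc (0 : ℝ) 1)
    {A₁ A₂ B₁ B₂ : Matrix n n ℂ} (hA₁ : A₁.PosSemidef) (hA₂ : A₂.PosSemidef)
    (hB₁ : B₁.PosSemidef) (hB₂ : B₂.PosSemidef) (K : Matrix n n ℂ) :
    l * (K * cfc (suppRpow p) A₁ * Kᴴ * cfc (suppRpow (1 - p)) B₁).trace.re +
        (1 - l) * (K * cfc (suppRpow p) A₂ * Kᴴ * cfc (suppRpow (1 - p)) B₂).trace.re ≤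
      (K * cfc (suppRpow p) ((l : ℂ) • A₁ + ((1 - l : ℝ) : ℂ) • A₂) * Kᴴ *
        cfc (suppRpow (1 - p)) ((l : ℂ) • B₁ + ((1 - l : ℝ) : ℂ) • B₂)).trace.re := by
  obtain ⟨μ, hμ⟩ := exists_measure_trace_eq_integral_parallelForm (n := n) hp
  obtain ⟨hi₁, he₁⟩ := hμ hA₁ hB₁ K
  obtain ⟨hi₂, he₂⟩ := hμ hA₂ hB₂ K
  obtain ⟨hi, he⟩ := hμ (posSemidef_convexCombination hl hA₁ hA₂)
    (posSemidef_convexCombination hl hB₁ hB₂) K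
  rw [he₁, he₂, he, ← MeasureTheory.integral_const_mul, ← MeasureTheory.integral_const_mul,
    ← MeasureTheory.integral_add (hi₁.const_mul l) (hi₂.const_mul (1 - l))]
  refine MeasureTheory.setIntegral_mono_on ((hi₁.const_mul l).add (hi₂.const_mul (1 - l))) hi
    measurableSet_Ioi fun t ht => ?_
  have ht : 0 < t := ht
  have h := mul_le_mul_of_nonneg_left (parallelForm_concave ht hl hA₁ hA₂ hB₁ hB₂ K)
    (Real.rpow_nonneg ht.le (p - 1))
  refine le_trans (le_of_eq ?_) h
  ring

end LiebConcavity

section Variational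

variable {n : Type*} [Fintype n] [DecidableEq n]

/-- **Young's inequality** for the trace. -/
lemma trace_mul_le_young {A B : Matrix n n ℂ} (hA : A.PosSemidef) (hB : B.PosSemidef) {r q : ℝ}
    (hrq : r.HolderConjugate q) :
    (A * B).trace.re ≤
      (cfc (suppRpow r) A).trace.re / r + (cfc (suppRpow q) B).trace.re / q := by
  have h := trace_cfc_mul_cfc hA.1 hB.1 1 (fun x => x) (fun x => x)
  have h₁ := trace_cfc_mul_cfc hA.1 hB.1 1 (suppRpow r) (fun _ => 1)
  have h₂ := trace_cfc_mul_cfc hA.1 hB.1 1 (fun _ => 1) (suppRpow q)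
  rw [cfc_id' ℝ A hA.1.isSelfAdjoint, cfc_id' ℝ B hB.1.isSelfAdjoint] at h
  rw [cfc_const_one ℝ B hB.1.isSelfAdjoint] at h₁
  rw [cfc_const_one ℝ A hA.1.isSelfAdjoint] at h₂
  simp only [Matrix.conjTranspose_one, one_mul, mul_one] at h h₁ h₂
  rw [h, h₁, h₂, Finset.sum_div, Finset.sum_div, ← Finset.sum_add_distrib]
  refine Finset.sum_le_sum fun i _ => ?_
  rw [Finset.sum_div, Finset.sum_div, ← Finset.sum_add_distrib]
  refine Finset.sum_le_sum fun j _ => ?_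
  rw [suppRpow_of_ne hrq.ne_zero, suppRpow_of_ne hrq.symm.ne_zero]
  have hy := mul_le_mul_of_nonneg_right
    (Real.young_inequality_of_nonneg (hA.eigenvalues_nonneg i) (hB.eigenvalues_nonneg j) hrq)
    (Complex.normSq_nonneg (eigenCoord hA.1 hB.1 1 j i))
  refine hy.trans (le_of_eq ?_)
  ring

/-- **Epstein's concavity theorem**: `A ↦ Tr (K A^p K*)^(1/p)` is concave for `0 < p < 1`. -/
lemma epstein_concavity {p : ℝ} (hp : p ∈ Set.Ioo (0 : ℝ) 1) {l : ℝ}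
    (hl : l ∈ Set.Icc (0 : ℝ) 1) {A₁ A₂ : Matrix n n ℂ} (hA₁ : A₁.PosSemidef)
    (hA₂ : A₂.PosSemidef) (K : Matrix n n ℂ) :
    l * (cfc (suppRpow p⁻¹) (K * cfc (suppRpow p) A₁ * Kᴴ)).trace.re +
        (1 - l) * (cfc (suppRpow p⁻¹) (K * cfc (suppRpow p) A₂ * Kᴴ)).trace.re ≤
      (cfc (suppRpow p⁻¹)
        (K * cfc (suppRpow p) ((l : ℂ) • A₁ + ((1 - l : ℝ) : ℂ) • A₂) * Kᴴ)).trace.re := by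
  have hp0 : p ≠ 0 := hp.1.ne'
  have hp1 : 0 < 1 - p := sub_pos.2 hp.2
  have hX : ∀ {A : Matrix n n ℂ}, A.PosSemidef → (K * cfc (suppRpow p) A * Kᴴ).PosSemidef :=
    fun hA => (hA.cfc_suppRpow p).mul_mul_conjTranspose_same K
  have hopt : ∀ {X : Matrix n n ℂ}, X.PosSemidef →
      X * cfc (suppRpow (1 - p)) (cfc (suppRpow p⁻¹) X) = cfc (suppRpow p⁻¹) X := by
    intro X hX
    rw [cfc_suppRpow_cfc_suppRpow hX]
    nth_rewrite 1 [← cfc_suppRpow_one hX.1]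
    rw [cfc_suppRpow_mul hX]
    congr 2
    field_simp
    ring
  have hY₁ := (hX hA₁).cfc_suppRpow p⁻¹
  have hY₂ := (hX hA₂).cfc_suppRpow p⁻¹
  have hY := posSemidef_convexCombination hl hY₁ hY₂
  have hlieb := lieb_concavity hp hl hA₁ hA₂ hY₁ hY₂ K
  rw [hopt (hX hA₁), hopt (hX hA₂)] at hlieb
  have hconj : (p⁻¹).HolderConjugate (1 - p)⁻¹ := by
    rw [Real.holderConjugate_iff]
    exact ⟨(one_lt_inv₀ hp.1).2 hp.2, by simp⟩
  have hyoung := trace_mul_le_young (hX (posSemidef_convexCombination hl hA₁ hA₂))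
    (hY.cfc_suppRpow (1 - p)) hconj
  rw [cfc_suppRpow_cfc_suppRpow hY, mul_inv_cancel₀ hp1.ne', cfc_suppRpow_one hY.1] at hyoung
  have h := hlieb.trans hyoung
  simp only [Matrix.trace_add, Matrix.trace_smul, smul_eq_mul, Complex.add_re,
    Complex.re_ofReal_mul, div_inv_eq_mul] at h
  refine le_of_mul_le_mul_right ?_ hp.1
  linarith

lemma Qalpha_exponent {α : ℝ} (hα : 1 < α) :
    (1 - α) / (2 * α) = -((α - 1) / α / 2) := by
  field_simp
  ring

lemma Qalpha_eq {α : ℝ} {ρ σ : Matrix n n ℂ} (hρ : ρ.PosSemidef) (hσ : σ.PosDef) :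
    Qalpha α ρ σ = (cfc (suppRpow α) (cfc (suppRpow ((1 - α) / (2 * α))) σ * ρ *
      cfc (suppRpow ((1 - α) / (2 * α))) σ)).trace.re := by
  have hs := (hσ.posSemidef.cfc_suppRpow ((1 - α) / (2 * α))).1
  have h := (hρ.mul_mul_conjTranspose_same (cfc (suppRpow ((1 - α) / (2 * α))) σ)).1
  rw [hs.eq] at h
  rw [Qalpha, matPow_eq_cfc hσ.1, matPow_eq_cfc h]

lemma Qalpha_one {ρ σ : Matrix n n ℂ} (hρ : ρ.PosSemidef) (hσ : σ.PosDef) :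
    Qalpha 1 ρ σ = ρ.trace.re := by
  rw [Qalpha_eq hρ hσ, sub_self, zero_div, cfc_suppRpow_zero hσ, Matrix.one_mul, Matrix.mul_one,
    cfc_suppRpow_one hρ.1]

lemma mul_trace_le_Qalpha_add {α : ℝ} (hα : 1 < α) {ρ σ : Matrix n n ℂ} (hρ : ρ.PosSemidef)
    (hσ : σ.PosDef) (K : Matrix n n ℂ) :
    α * (K * ρ * Kᴴ).trace.re ≤ Qalpha α ρ σ + (α - 1) *
      (cfc (suppRpow ((α - 1) / α)⁻¹) (K * cfc (suppRpow ((α - 1) / α)) σ * Kᴴ)).trace.re := by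
  have hα0 : 0 < α := by linarith
  rw [Qalpha_eq hρ hσ, Qalpha_exponent hα]
  set p := (α - 1) / α with hp
  have hss := cfc_suppRpow_mul hσ.posSemidef (p / 2) (p / 2)
  have hsi := cfc_suppRpow_mul hσ.posSemidef (p / 2) (-(p / 2))
  have his := cfc_suppRpow_mul hσ.posSemidef (-(p / 2)) (p / 2)
  have hs := (hσ.posSemidef.cfc_suppRpow (p / 2)).1
  have hi := (hσ.posSemidef.cfc_suppRpow (-(p / 2))).1
  rw [add_halves] at hss
  rw [add_neg_cancel, cfc_suppRpow_zero hσ] at hsi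
  rw [neg_add_cancel, cfc_suppRpow_zero hσ] at his
  rw [← hss]
  generalize cfc (suppRpow (p / 2)) σ = s at *
  generalize cfc (suppRpow (-(p / 2))) σ = s' at *
  have hR := hρ.mul_mul_conjTranspose_same s'
  rw [hi.eq] at hR
  have hconj : α.HolderConjugate p⁻¹ := by
    rw [Real.holderConjugate_iff]
    refine ⟨hα, ?_⟩
    rw [inv_inv, hp]
    field_simp
    ring
  have hy := trace_mul_le_young hR (posSemidef_conjTranspose_mul_self (K * s)) hconj
  have h1 : K * (s * s) * Kᴴ = (K * s) * (K * s)ᴴ := by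
    rw [Matrix.conjTranspose_mul, hs.eq]
    simp only [Matrix.mul_assoc]
  have h2 : (K * ρ * Kᴴ).trace = (s' * ρ * s' * ((K * s)ᴴ * (K * s))).trace := by
    rw [Matrix.conjTranspose_mul, hs.eq, ← Matrix.mul_assoc (s' * ρ * s'),
      Matrix.trace_mul_comm _ (K * s)]
    have : K * s * (s' * ρ * s' * (s * Kᴴ)) = K * (s * s') * ρ * (s' * s) * Kᴴ := by
      simp only [Matrix.mul_assoc]
    rw [this, hsi, his, Matrix.mul_one, Matrix.mul_one]
  rw [h1, ← trace_cfc_conjTranspose_mul_self, h2]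
  refine (mul_le_mul_of_nonneg_left hy hα0.le).trans (le_of_eq ?_)
  rw [div_inv_eq_mul, hp]
  field_simp

lemma exists_mul_trace_eq_Qalpha_add {α : ℝ} (hα : 1 < α) {ρ σ : Matrix n n ℂ}
    (hρ : ρ.PosSemidef) (hσ : σ.PosDef) :
    ∃ K : Matrix n n ℂ, α * (K * ρ * Kᴴ).trace.re = Qalpha α ρ σ + (α - 1) *
      (cfc (suppRpow ((α - 1) / α)⁻¹) (K * cfc (suppRpow ((α - 1) / α)) σ * Kᴴ)).trace.re := by
  have hα0 : 0 < α := by linarith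
  have hα1 : α - 1 ≠ 0 := (sub_pos.2 hα).ne'
  rw [Qalpha_eq hρ hσ, Qalpha_exponent hα]
  set p := (α - 1) / α with hp
  have hss := cfc_suppRpow_mul hσ.posSemidef (p / 2) (p / 2)
  have hsi := cfc_suppRpow_mul hσ.posSemidef (p / 2) (-(p / 2))
  have his := cfc_suppRpow_mul hσ.posSemidef (-(p / 2)) (p / 2)
  have hi := (hσ.posSemidef.cfc_suppRpow (-(p / 2))).1
  rw [add_halves] at hss
  rw [add_neg_cancel, cfc_suppRpow_zero hσ] at hsi
  rw [neg_add_cancel, cfc_suppRpow_zero hσ] at his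
  rw [← hss]
  generalize cfc (suppRpow (p / 2)) σ = s at *
  generalize cfc (suppRpow (-(p / 2))) σ = s' at *
  have hR := hρ.mul_mul_conjTranspose_same s'
  rw [hi.eq] at hR
  set R := s' * ρ * s' with hRdef
  have hM := (hR.cfc_suppRpow ((α - 1) / 2)).1
  have hMM := cfc_suppRpow_mul hR ((α - 1) / 2) ((α - 1) / 2)
  rw [add_halves] at hMM
  set M := cfc (suppRpow ((α - 1) / 2)) R
  refine ⟨M * s', ?_⟩
  rw [Matrix.conjTranspose_mul, hi.eq, hM.eq]
  have h1 : M * s' * (s * s) * (s' * M) = cfc (suppRpow (α - 1)) R := by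
    have : M * s' * (s * s) * (s' * M) = M * (s' * s) * (s * s') * M := by
      simp only [Matrix.mul_assoc]
    rw [this, his, hsi, Matrix.mul_one, Matrix.mul_one, hMM]
  have h2 : (M * s' * ρ * (s' * M)).trace = (cfc (suppRpow α) R).trace := by
    have : M * s' * ρ * (s' * M) = M * (R * M) := by
      simp only [hRdef, Matrix.mul_assoc]
    rw [this, Matrix.trace_mul_comm, Matrix.mul_assoc, hMM]
    nth_rewrite 1 [← cfc_suppRpow_one hR.1]
    rw [cfc_suppRpow_mul hR, add_sub_cancel]
  have h3 : (α - 1) * p⁻¹ = α := by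
    rw [hp]
    field_simp
  rw [h1, h2, cfc_suppRpow_cfc_suppRpow hR, h3]
  ring

end Variational

/-- joint convexity of `Q_α` for `α ∈ [1, 2]`. -/
theorem stmt7 {n : ℕ} {α : ℝ} (hα : α ∈ Set.Icc (1 : ℝ) 2)
    {l : ℝ} (hl : l ∈ Set.Icc (0 : ℝ) 1)
    {ρ₁ ρ₂ σ₁ σ₂ : Matrix (Fin n) (Fin n) ℂ}
    (hρ₁ : ρ₁.PosSemidef) (hρ₂ : ρ₂.PosSemidef) (hσ₁ : σ₁.PosDef) (hσ₂ : σ₂.PosDef) :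
    Qalpha α ((l : ℂ) • ρ₁ + ((1 - l : ℝ) : ℂ) • ρ₂)
        ((l : ℂ) • σ₁ + ((1 - l : ℝ) : ℂ) • σ₂)
      ≤ l * Qalpha α ρ₁ σ₁ + (1 - l) * Qalpha α ρ₂ σ₂ := by
  have hl' : 0 ≤ 1 - l := sub_nonneg.2 hl.2
  have hρ := posSemidef_convexCombination hl hρ₁ hρ₂
  have hσ : ((l : ℂ) • σ₁ + ((1 - l : ℝ) : ℂ) • σ₂).PosDef := by
    rcases hl.1.eq_or_lt with rfl | h0
    · simpa using hσ₂
    · exact (hσ₁.smul (by exact_mod_cast h0)).add_posSemidef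
        (hσ₂.posSemidef.smul (by exact_mod_cast hl'))
  have htrace : ∀ K : Matrix (Fin n) (Fin n) ℂ,
      (K * ((l : ℂ) • ρ₁ + ((1 - l : ℝ) : ℂ) • ρ₂) * Kᴴ).trace.re =
        l * (K * ρ₁ * Kᴴ).trace.re + (1 - l) * (K * ρ₂ * Kᴴ).trace.re := by
    intro K
    simp only [Matrix.mul_add, Matrix.add_mul, Matrix.mul_smul, Matrix.smul_mul,
      Matrix.trace_add, Matrix.trace_smul, smul_eq_mul, Complex.add_re, Complex.re_ofReal_mul]
  rcases hα.1.eq_or_lt with rfl | hα1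
  · rw [Qalpha_one hρ hσ, Qalpha_one hρ₁ hσ₁, Qalpha_one hρ₂ hσ₂]
    simp
  · obtain ⟨K, hK⟩ := exists_mul_trace_eq_Qalpha_add hα1 hρ hσ
    have h₁ := mul_le_mul_of_nonneg_left (mul_trace_le_Qalpha_add hα1 hρ₁ hσ₁ K) hl.1
    have h₂ := mul_le_mul_of_nonneg_left (mul_trace_le_Qalpha_add hα1 hρ₂ hσ₂ K) hl'
    have hp : (α - 1) / α ∈ Set.Ioo (0 : ℝ) 1 := by
      refine ⟨div_pos (by linarith) (by linarith), ?_⟩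
      rw [div_lt_one (by linarith)]
      linarith
    have hΨ := mul_le_mul_of_nonneg_left
      (epstein_concavity hp hl hσ₁.posSemidef hσ₂.posSemidef K) (sub_pos.2 hα1).le
    rw [htrace] at hK
    linarith
end
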